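/- Let (𝔡, 𝔤) be a Lie pair of Lie algebras with a fixed linear splitting (j, p), ∇ : 𝔡 → End(B) an extension of the quotient 𝔤-action on B, and R_n (n ≥ 2) the associated higher Atiyah maps. Then for all a ∈ 𝔤 and b₀, b₁, b₂ ∈ B: R₃(b₀, b₁, b₂)(a) − R₃(b₁, b₀, b₂)(a) = R₂(β(b₀, b₁), b₂)(a) − [ a·(Ω(b₀, b₁)(b₂)) − Ω(b₀, b₁)(a·b₂) − Ω(a·b₀, b₁)(b₂) − Ω(b₀, a·b₁)(b₂) ], where β(b₁, b₂) = ∇_{j(b₁)}b₂ − ∇_{j(b₂)}b₁ − q([j(b₁), j(b₂)]) and Ω(b₁, b₂) = ∇_{j(b₁)}∘∇_{j(b₂)} − ∇_{j(b₂)}∘∇_{j(b₁)} − ∇_{[j(b₁), j(b₂)]} ∈ End(B). -/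

import Mathlib

/-- The quotient action of a Lie subalgebra `𝔤` on `B = 𝔡 ⧸ 𝔤`, `a · q(l) = q ⁅a, l⁆`. -/
def qact {k : Type*} [Field k] {d : Type*} [LieRing d] [LieAlgebra k d]
    (g : LieSubalgebra k d) (a : g) :
    (d ⧸ g.toSubmodule) →ₗ[k] (d ⧸ g.toSubmodule) :=
  Submodule.mapQ g.toSubmodule g.toSubmodule (LieAlgebra.ad k d (a : d))
    (fun x hx => by
      rw [Submodule.mem_comap, LieAlgebra.ad_apply]
      exact g.lie_mem a.2 hx)

/-- The higher Atiyah maps `R_n : Bⁿ → Hom(𝔤, B)` of a Lie pair with splitting `(j, p)`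
and extension `∇`: `R₂(b₁,b₂)(a) = R^∇(a; b₁)(b₂)` and
`R_{n+1}(b₀,…,b_n)(a) = Σ_j R_n(b₁,…,∇_{j(b₀)}b_j,…,b_n)(a) + R_n(b₁,…,b_n)(δ_{b₀}(a))
  − ∇_{j(b₀)}(R_n(b₁,…,b_n)(a))`. -/
def hR {k : Type*} [Field k] {d : Type*} [LieRing d] [LieAlgebra k d]
    (g : LieSubalgebra k d)
    (nab : d →ₗ[k] Module.End k (d ⧸ g.toSubmodule))
    (jmap : (d ⧸ g.toSubmodule) →ₗ[k] d) (pmap : d →ₗ[k] g) :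
    (n : ℕ) → (Fin n → (d ⧸ g.toSubmodule)) → g → (d ⧸ g.toSubmodule)
  | 0, _, _ => 0
  | 1, _, _ => 0
  | 2, b, a =>
      nab (a : d) (nab (jmap (b 0)) (b 1)) - nab (jmap (b 0)) (nab (a : d) (b 1))
        - nab ⁅(a : d), jmap (b 0)⁆ (b 1)
  | (n+3), b, a =>
      (∑ i : Fin (n+2), hR g nab jmap pmap (n+2)
          (Function.update (fun m : Fin (n+2) => b m.succ) i (nab (jmap (b 0)) (b i.succ))) a)
      + hR g nab jmap pmap (n+2) (fun m => b m.succ) (pmap ⁅jmap (b 0), (a : d)⁆)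
      - nab (jmap (b 0)) (hR g nab jmap pmap (n+2) (fun m => b m.succ) a)

/-- The torsion `β(b₁, b₂) = ∇_{j(b₁)}b₂ − ∇_{j(b₂)}b₁ − q([j(b₁), j(b₂)])`. -/
def torsionB {k : Type*} [Field k] {d : Type*} [LieRing d] [LieAlgebra k d]
    (g : LieSubalgebra k d)
    (nab : d →ₗ[k] Module.End k (d ⧸ g.toSubmodule))
    (jmap : (d ⧸ g.toSubmodule) →ₗ[k] d) (b₁ b₂ : d ⧸ g.toSubmodule) :
    d ⧸ g.toSubmodule :=
  nab (jmap b₁) b₂ - nab (jmap b₂) b₁ - g.toSubmodule.mkQ ⁅jmap b₁, jmap b₂⁆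

/-- The curvature `Ω(b₁, b₂) = ∇_{j(b₁)}∘∇_{j(b₂)} − ∇_{j(b₂)}∘∇_{j(b₁)} − ∇_{[j(b₁), j(b₂)]}`. -/
def omegaB {k : Type*} [Field k] {d : Type*} [LieRing d] [LieAlgebra k d]
    (g : LieSubalgebra k d)
    (nab : d →ₗ[k] Module.End k (d ⧸ g.toSubmodule))
    (jmap : (d ⧸ g.toSubmodule) →ₗ[k] d) (b₁ b₂ : d ⧸ g.toSubmodule) :
    Module.End k (d ⧸ g.toSubmodule) :=
  nab (jmap b₁) ∘ₗ nab (jmap b₂) - nab (jmap b₂) ∘ₗ nab (jmap b₁) - nab ⁅jmap b₁, jmap b₂⁆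

section AtiyahHelpers

variable {k : Type*} [Field k] {d : Type*} [LieRing d] [LieAlgebra k d] (g : LieSubalgebra k d)

theorem qact_mkQ (a : g) (l : d) :
    qact g a (g.toSubmodule.mkQ l) = g.toSubmodule.mkQ ⁅(a : d), l⁆ := rfl

theorem qact_lie (a c : g) (b : d ⧸ g.toSubmodule) :
    qact g ⁅a, c⁆ b = qact g a (qact g c b) - qact g c (qact g a b) := by
  obtain ⟨l, rfl⟩ := g.toSubmodule.mkQ_surjective b
  simp only [qact_mkQ, ← map_sub, LieSubalgebra.coe_bracket, lie_lie]

theorem hR_two (nab : d →ₗ[k] Module.End k (d ⧸ g.toSubmodule))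
    (jmap : (d ⧸ g.toSubmodule) →ₗ[k] d) (pmap : d →ₗ[k] g)
    (b : Fin 2 → d ⧸ g.toSubmodule) (a : g) :
    hR g nab jmap pmap 2 b a =
      nab (a : d) (nab (jmap (b 0)) (b 1)) - nab (jmap (b 0)) (nab (a : d) (b 1))
        - nab ⁅(a : d), jmap (b 0)⁆ (b 1) := rfl

theorem hR_three (nab : d →ₗ[k] Module.End k (d ⧸ g.toSubmodule))
    (jmap : (d ⧸ g.toSubmodule) →ₗ[k] d) (pmap : d →ₗ[k] g)
    (b₀ b₁ b₂ : d ⧸ g.toSubmodule) (a : g) :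
    hR g nab jmap pmap 3 ![b₀, b₁, b₂] a =
      hR g nab jmap pmap 2 ![nab (jmap b₀) b₁, b₂] a
        + hR g nab jmap pmap 2 ![b₁, nab (jmap b₀) b₂] a
        + hR g nab jmap pmap 2 ![b₁, b₂] (pmap ⁅jmap b₀, (a : d)⁆)
        - nab (jmap b₀) (hR g nab jmap pmap 2 ![b₁, b₂] a) := by
  conv_lhs => rw [hR, Fin.sum_univ_two]
  rfl

end AtiyahHelpers

/-- For a Lie pair with splitting and an extension `∇` of the quotient
`𝔤`-action on `B`, with torsion `β` and curvature `Ω`: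
`R₃(b₀,b₁,b₂)(a) − R₃(b₁,b₀,b₂)(a) = R₂(β(b₀,b₁), b₂)(a)
  − [a·(Ω(b₀,b₁)(b₂)) − Ω(b₀,b₁)(a·b₂) − Ω(a·b₀,b₁)(b₂) − Ω(b₀,a·b₁)(b₂)]`. -/
theorem atiyah_stmt14 (k : Type*) [Field k] (d : Type*) [LieRing d] [LieAlgebra k d]
    (g : LieSubalgebra k d)
    (jmap : (d ⧸ g.toSubmodule) →ₗ[k] d) (pmap : d →ₗ[k] g)
    (hj : ∀ b : d ⧸ g.toSubmodule, g.toSubmodule.mkQ (jmap b) = b)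
    (hp : ∀ a : g, pmap (a : d) = a)
    (hjp : ∀ l : d, jmap (g.toSubmodule.mkQ l) + ((pmap l : g) : d) = l)
    (nab : d →ₗ[k] Module.End k (d ⧸ g.toSubmodule))
    (hext : ∀ (a : g) (b : d ⧸ g.toSubmodule), nab (a : d) b = qact g a b) :
    ∀ (a : g) (b₀ b₁ b₂ : d ⧸ g.toSubmodule),
      hR g nab jmap pmap 3 ![b₀, b₁, b₂] a - hR g nab jmap pmap 3 ![b₁, b₀, b₂] a
        = hR g nab jmap pmap 2 ![torsionB g nab jmap b₀ b₁, b₂] a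
          - (qact g a (omegaB g nab jmap b₀ b₁ b₂)
             - omegaB g nab jmap b₀ b₁ (qact g a b₂)
             - omegaB g nab jmap (qact g a b₀) b₁ b₂
             - omegaB g nab jmap b₀ (qact g a b₁) b₂) := by
  intro a b₀ b₁ b₂
  have hjq (l : d) : jmap (g.toSubmodule.mkQ l) = l - (pmap l : d) :=
    eq_sub_of_add_eq (hjp l)
  have hjact (b : d ⧸ g.toSubmodule) :
      jmap (nab a b) = ⁅(a : d), jmap b⁆ - (pmap ⁅(a : d), jmap b⁆ : d) := by
    rw [← hjq, ← qact_mkQ, hj, hext]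
  have hflat (c : g) :
      nab ⁅(a : d), (c : d)⁆ b₂ = nab (a : d) (nab c b₂) - nab c (nab (a : d) b₂) := by
    simp only [hext, ← LieSubalgebra.coe_bracket, qact_lie]
  have hskew (b : d ⧸ g.toSubmodule) :
      pmap ⁅jmap b, (a : d)⁆ = -pmap ⁅(a : d), jmap b⁆ := by
    rw [← lie_skew, map_neg]
  have hjac : nab ⁅(a : d), ⁅jmap b₀, jmap b₁⁆⁆ b₂
      = nab ⁅⁅(a : d), jmap b₀⁆, jmap b₁⁆ b₂ + nab ⁅jmap b₀, ⁅(a : d), jmap b₁⁆⁆ b₂ := by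
    rw [leibniz_lie, map_add, LinearMap.add_apply]
  have hswap : nab ⁅(pmap ⁅(a : d), jmap b₁⁆ : d), jmap b₀⁆ b₂
      = -nab ⁅jmap b₀, (pmap ⁅(a : d), jmap b₁⁆ : d)⁆ b₂ := by
    rw [← lie_skew, map_neg, LinearMap.neg_apply]
  simp only [hR_three, hR_two, Matrix.cons_val_zero, Matrix.cons_val_one, torsionB, omegaB,
    hskew, hjact, hjq, ← hext, map_sub, map_neg, lie_sub, sub_lie, neg_lie,
    LinearMap.sub_apply, LinearMap.neg_apply, LinearMap.comp_apply, NegMemClass.coe_neg,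
    hflat, hjac, hswap]
  abel
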